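/- Let n ≥ 1 and let E_i (i = 1,…,n) be smooth functions of (t, x, v) on all of ℝ × (ℝⁿ)² (a first-order system of ordinary differential expressions). Then there exists a smooth first-order Lagrange function L(t, x, v) on ℝ × (ℝⁿ)² with ∂L/∂x^i − D_t(∂L/∂v^i) = E_i identically (as functions of (t, x, v, w)) if and only if there exist smooth functions Ψ_{ij}(t, x) with Ψ_{ij} = −Ψ_{ji} and ψ_i(t, x) such that E_i = Ψ_{ij} v^j + ψ_i, and identically: ∂Ψ_{jk}/∂x^i + ∂Ψ_{ki}/∂x^j + ∂Ψ_{ij}/∂x^k = 0 and ∂ψ_j/∂x^i − ∂ψ_i/∂x^j + ∂Ψ_{ij}/∂t = 0. -/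

import Mathlib

noncomputable section

/-- Jet variables: time `t` together with rows `y₀, …, y_{N-1}` of `n` variables each. -/
abbrev Jet (n N : ℕ) : Type := ℝ × (Fin N → Fin n → ℝ)

/-- Coordinate access, out-of-range rows giving `0`. -/
def coord {n N : ℕ} (p : Jet n N) (r : ℕ) (i : Fin n) : ℝ :=
  if h : r < N then p.2 ⟨r, h⟩ i else 0

/-- Partial derivative in the time direction. -/
def pderT {n N : ℕ} (F : Jet n N → ℝ) (p : Jet n N) : ℝ :=
  fderiv ℝ F p (1, 0)

/-- Partial derivative in the `i`-th variable of the `r`-th row `y_r`. -/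
def pderY {n N : ℕ} (r : ℕ) (i : Fin n) (F : Jet n N → ℝ) : Jet n N → ℝ :=
  fun p => fderiv ℝ F p (0, fun r' => if (r' : ℕ) = r then Pi.single i 1 else 0)

/-- The total (formal time) derivative `D_t F = ∂F/∂t + Σ_r Σ_i y_{r+1}^i ∂F/∂y_r^i`,
truncated at the top row. -/
def totD {n N : ℕ} (F : Jet n N → ℝ) : Jet n N → ℝ :=
  fun p => pderT F p + ∑ r ∈ Finset.range N, ∑ i : Fin n, coord p (r + 1) i * pderY r i F p

/-- Extension of a function of a lower-order jet to a higher-order jet space. -/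
def extJ {n : ℕ} {N M : ℕ} (h : N ≤ M) (F : Jet n N → ℝ) : Jet n M → ℝ :=
  fun p => F (p.1, fun r => p.2 (Fin.castLE h r))

/-- Truncation of a jet to lower order. -/
def trJ {n : ℕ} {M : ℕ} (N : ℕ) (h : N ≤ M) (p : Jet n M) : Jet n N :=
  (p.1, fun r => p.2 (Fin.castLE h r))


section ParametricIntegral

variable {V : Type*} [NormedAddCommGroup V] [NormedSpace ℝ V]

theorem hasFDerivAt_section {f : ℝ × V → ℝ} (hf : ContDiff ℝ 1 f) (s : ℝ) (x : V) :
    HasFDerivAt (fun y => f (s, y)) ((fderiv ℝ f (s, x)).comp (ContinuousLinearMap.inr ℝ ℝ V)) x :=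
  ((hf.differentiable one_ne_zero) (s, x)).hasFDerivAt.comp x (hasFDerivAt_prodMk_right s x)

theorem contDiff_fderiv_section_apply {f : ℝ × V → ℝ} (hf : ContDiff ℝ (⊤ : ℕ∞) f) (u : V) :
    ContDiff ℝ (⊤ : ℕ∞) (fun z : ℝ × V => fderiv ℝ (fun y => f (z.1, y)) z.2 u) := by
  have h : (fun z : ℝ × V => fderiv ℝ (fun y => f (z.1, y)) z.2 u) =
      fun z => fderiv ℝ f z (0, u) := by
    ext z
    rw [(hasFDerivAt_section (hf.of_le (by simp)) z.1 z.2).fderiv]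
    simp
  rw [h]
  exact (hf.fderiv_right (by simp)).clm_apply contDiff_const

variable [FiniteDimensional ℝ V]

theorem hasFDerivAt_integral_section {f : ℝ × V → ℝ} (hf : ContDiff ℝ 1 f) (x : V) :
    HasFDerivAt (fun y => ∫ s in (0 : ℝ)..1, f (s, y))
      (∫ s in (0 : ℝ)..1, (fderiv ℝ f (s, x)).comp (ContinuousLinearMap.inr ℝ ℝ V)) x := by
  have hc : Continuous fun z : ℝ × V =>
      (fderiv ℝ f z).comp (ContinuousLinearMap.inr ℝ ℝ V) :=
    (hf.continuous_fderiv one_ne_zero).clm_comp continuous_const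
  obtain ⟨C, hC⟩ := (isCompact_Icc (a := (0 : ℝ)) (b := 1)).prod (isCompact_closedBall x 1)
    |>.exists_bound_of_continuousOn hc.continuousOn
  refine intervalIntegral.hasFDerivAt_integral_of_dominated_of_fderiv_le
    (F := fun y s => f (s, y))
    (F' := fun y s => (fderiv ℝ f (s, y)).comp (ContinuousLinearMap.inr ℝ ℝ V))
    (bound := fun _ => C) (Metric.closedBall_mem_nhds x one_pos) ?_ ?_ ?_ ?_ ?_ ?_
  · exact .of_forall fun y =>
      (hf.continuous.comp (by fun_prop : Continuous fun s : ℝ => (s, y))).aestronglyMeasurable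
  · exact (hf.continuous.comp (by fun_prop : Continuous fun s : ℝ => (s, x))).intervalIntegrable _ _
  · exact (hc.comp (by fun_prop : Continuous fun s : ℝ => (s, x))).aestronglyMeasurable
  · refine .of_forall fun s hs y hy => hC (s, y) ⟨?_, hy⟩
    rw [Set.uIoc_of_le zero_le_one] at hs
    exact ⟨hs.1.le, hs.2⟩
  · exact intervalIntegrable_const
  · exact .of_forall fun s _ y _ => hasFDerivAt_section hf s y

theorem fderiv_integral_section_apply {f : ℝ × V → ℝ} (hf : ContDiff ℝ 1 f) (x u : V) :
    fderiv ℝ (fun y => ∫ s in (0 : ℝ)..1, f (s, y)) x u =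
      ∫ s in (0 : ℝ)..1, fderiv ℝ (fun y => f (s, y)) x u := by
  rw [(hasFDerivAt_integral_section hf x).fderiv, ContinuousLinearMap.intervalIntegral_apply]
  · simp only [(hasFDerivAt_section hf _ x).fderiv]
  · refine Continuous.intervalIntegrable ?_ _ _
    exact ((hf.continuous_fderiv one_ne_zero).comp
      (by fun_prop : Continuous fun s : ℝ => (s, x))).clm_comp continuous_const

theorem contDiff_integral_section {f : ℝ × V → ℝ} (hf : ContDiff ℝ (⊤ : ℕ∞) f) :
    ContDiff ℝ (⊤ : ℕ∞) (fun y => ∫ s in (0 : ℝ)..1, f (s, y)) := by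
  rw [contDiff_infty]
  intro m
  induction m generalizing f with
  | zero =>
    exact contDiff_zero.2
      (continuous_iff_continuousAt.2 fun x =>
        (hasFDerivAt_integral_section (hf.of_le (by simp)) x).continuousAt)
  | succ m ih =>
    have h1 : ContDiff ℝ 1 f := hf.of_le (by simp)
    rw [Nat.cast_succ, contDiff_succ_iff_fderiv_apply]
    refine ⟨fun x => (hasFDerivAt_integral_section h1 x).differentiableAt, by simp, fun u => ?_⟩
    simp only [fderiv_integral_section_apply h1]
    exact ih (contDiff_fderiv_section_apply hf u)

end ParametricIntegral

theorem fderiv_fderiv_apply_comm {V : Type*} [NormedAddCommGroup V] [NormedSpace ℝ V]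
    {f : V → ℝ} (hf : ContDiff ℝ (⊤ : ℕ∞) f) (x u v : V) :
    fderiv ℝ (fun y => fderiv ℝ f y u) x v = fderiv ℝ (fun y => fderiv ℝ f y v) x u := by
  have hd : DifferentiableAt ℝ (fderiv ℝ f) x :=
    ((hf.fderiv_right (m := (⊤ : ℕ∞)) (by simp)).differentiable (by simp)) x
  rw [fderiv_clm_apply hd (by fun_prop), fderiv_clm_apply hd (by fun_prop)]
  simpa using (hf.contDiffAt.isSymmSndFDerivAt
    (by simpa using WithTop.coe_le_coe.2 (le_top (a := (2 : ℕ∞))))).eq v u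

section Jets

variable {n N M : ℕ}

/-- Truncation of jets as a continuous linear map. -/
def trCLM (n : ℕ) (h : N ≤ M) : Jet n M →L[ℝ] Jet n N :=
  (ContinuousLinearMap.fst ℝ ℝ (Fin M → Fin n → ℝ)).prod
    (ContinuousLinearMap.pi fun r =>
      (ContinuousLinearMap.proj (R := ℝ) (φ := fun _ : Fin M => Fin n → ℝ) (Fin.castLE h r)).comp
        (ContinuousLinearMap.snd ℝ ℝ (Fin M → Fin n → ℝ)))

/-- The coordinate direction of the variable `y_r^i`. -/
def dirY (r : ℕ) (i : Fin n) : Jet n N :=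
  (0, fun r' => if (r' : ℕ) = r then Pi.single i 1 else 0)

theorem coord_add (p u : Jet n N) (r : ℕ) (i : Fin n) :
    coord (p + u) r i = coord p r i + coord u r i := by
  unfold coord; split <;> simp

theorem coord_smul (c : ℝ) (p : Jet n N) (r : ℕ) (i : Fin n) :
    coord (c • p) r i = c * coord p r i := by
  unfold coord; split <;> simp

theorem coord_dirY {r : ℕ} (hr : r < N) (i : Fin n) (r' : ℕ) (j : Fin n) :
    coord (dirY r i : Jet n N) r' j = if r' = r ∧ j = i then 1 else 0 := by
  unfold coord dirY
  by_cases h : r' = r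
  · subst h; simp [hr, Pi.single_apply]
  · simp [h]

theorem coord_dirT (r : ℕ) (i : Fin n) : coord ((1, 0) : Jet n N) r i = 0 := by
  simp [coord]

/-- The coordinate `y_r^i` as a continuous linear functional. -/
def coordCLM (r : ℕ) (i : Fin n) : Jet n N →L[ℝ] ℝ :=
  LinearMap.toContinuousLinearMap
    { toFun := fun p => coord p r i
      map_add' := fun p u => coord_add p u r i
      map_smul' := fun c p => coord_smul c p r i }

theorem contDiff_coord {m : WithTop ℕ∞} (r : ℕ) (i : Fin n) :
    ContDiff ℝ m fun p : Jet n N => coord p r i :=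
  (coordCLM r i).contDiff

theorem fderiv_coord_mul {F : Jet n N → ℝ} {p : Jet n N} (hF : DifferentiableAt ℝ F p)
    (r : ℕ) (i : Fin n) (u : Jet n N) :
    fderiv ℝ (fun p => coord p r i * F p) p u
      = coord p r i * fderiv ℝ F p u + coord u r i * F p := by
  have h : HasFDerivAt (fun p : Jet n N => coord p r i) (coordCLM r i) p :=
    (coordCLM r i).hasFDerivAt
  rw [(h.fun_mul hF.hasFDerivAt).fderiv]
  simp [coordCLM, mul_comm]

theorem fderiv_sum_coord_mul {F : Fin n → Jet n N → ℝ} {p : Jet n N}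
    (hF : ∀ i, DifferentiableAt ℝ (F i) p) (r : ℕ) (u : Jet n N) :
    fderiv ℝ (fun p => ∑ i, coord p r i * F i p) p u
      = ∑ i, coord p r i * fderiv ℝ (F i) p u + ∑ i, coord u r i * F i p := by
  have hc (i : Fin n) : DifferentiableAt ℝ (fun p : Jet n N => coord p r i) p :=
    ((contDiff_coord (m := 1) r i).differentiable one_ne_zero) p
  rw [fderiv_fun_sum fun i _ => (hc i).fun_mul (hF i), sum_apply,
    ← Finset.sum_add_distrib]
  exact Finset.sum_congr rfl fun i _ => fderiv_coord_mul (hF i) r i u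

theorem contDiff_pderT {F : Jet n N → ℝ} (hF : ContDiff ℝ (⊤ : ℕ∞) F) :
    ContDiff ℝ (⊤ : ℕ∞) (pderT F) :=
  (hF.fderiv_right (by simp)).clm_apply contDiff_const

theorem contDiff_pderY {F : Jet n N → ℝ} (hF : ContDiff ℝ (⊤ : ℕ∞) F) (r : ℕ) (i : Fin n) :
    ContDiff ℝ (⊤ : ℕ∞) (pderY r i F) :=
  (hF.fderiv_right (by simp)).clm_apply contDiff_const

theorem contDiff_extJ {F : Jet n N → ℝ} (hF : ContDiff ℝ (⊤ : ℕ∞) F) (h : N ≤ M) :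
    ContDiff ℝ (⊤ : ℕ∞) (extJ h F) :=
  hF.comp (trCLM n h).contDiff

theorem fderiv_extJ {F : Jet n N → ℝ} (hF : ContDiff ℝ (⊤ : ℕ∞) F) (h : N ≤ M)
    (p u : Jet n M) :
    fderiv ℝ (extJ h F) p u = fderiv ℝ F (trJ N h p) (trJ N h u) := by
  have : HasFDerivAt (extJ h F) ((fderiv ℝ F (trJ N h p)).comp (trCLM n h)) p :=
    ((hF.differentiable (by simp)) (trJ N h p)).hasFDerivAt.comp p (trCLM n h).hasFDerivAt
  rw [this.fderiv]
  rfl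

theorem pderT_extJ {F : Jet n N → ℝ} (hF : ContDiff ℝ (⊤ : ℕ∞) F) (h : N ≤ M) :
    pderT (extJ h F) = extJ h (pderT F) :=
  funext fun p => fderiv_extJ hF h p _

theorem pderY_extJ {F : Jet n N → ℝ} (hF : ContDiff ℝ (⊤ : ℕ∞) F) (h : N ≤ M) (r : ℕ)
    (i : Fin n) : pderY r i (extJ h F) = extJ h (pderY r i F) :=
  funext fun p => fderiv_extJ hF h p _

theorem pderY_of_le {r : ℕ} (hr : N ≤ r) (i : Fin n) (F : Jet n N → ℝ) (p : Jet n N) :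
    pderY r i F p = 0 := by
  have : (fun r' : Fin N => if (r' : ℕ) = r then (Pi.single i 1 : Fin n → ℝ) else 0) = 0 := by
    ext r'
    rw [if_neg (by omega)]
    rfl
  rw [pderY, this]
  exact map_zero _

theorem coord_trJ (h : N ≤ M) (p : Jet n M) {r : ℕ} (hr : r < N) (i : Fin n) :
    coord (trJ N h p) r i = coord p r i := by
  simp [coord, trJ, hr, hr.trans_le h]

/-- The Euler–Poisson expressions of a first-order Lagrange function in terms of its second
derivatives. -/
theorem eulerPoisson_eq {L : Jet n 2 → ℝ} (hL : ContDiff ℝ (⊤ : ℕ∞) L) (h : 2 ≤ 3) (i : Fin n)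
    (p : Jet n 3) :
    pderY 0 i (extJ h L) p - totD (pderY 1 i (extJ h L)) p =
      pderY 0 i L (trJ 2 h p) - (pderT (pderY 1 i L) (trJ 2 h p)
        + ∑ j, coord p 1 j * pderY 0 j (pderY 1 i L) (trJ 2 h p)
        + ∑ j, coord p 2 j * pderY 1 j (pderY 1 i L) (trJ 2 h p)) := by
  have hG := contDiff_pderY hL 1 i
  simp only [totD, pderY_extJ hL, pderY_extJ hG, pderT_extJ hG, Finset.sum_range_succ,
    Finset.sum_range_zero]
  simp only [extJ, pderY_of_le le_rfl, mul_zero, Finset.sum_const_zero, trJ]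
  ring

/-- A Lagrange function affine in the velocities. -/
def affineLagrangian (A : Fin n → Jet n 1 → ℝ) (B : Jet n 1 → ℝ) (h : 1 ≤ 2) : Jet n 2 → ℝ :=
  fun q => extJ h B q + ∑ j, coord q 1 j * extJ h (A j) q

section Affine

variable {A : Fin n → Jet n 1 → ℝ} {B : Jet n 1 → ℝ}

theorem contDiff_affineLagrangian (hA : ∀ j, ContDiff ℝ (⊤ : ℕ∞) (A j))
    (hB : ContDiff ℝ (⊤ : ℕ∞) B) (h : 1 ≤ 2) :
    ContDiff ℝ (⊤ : ℕ∞) (affineLagrangian A B h) :=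
  (contDiff_extJ hB h).add
    (ContDiff.sum fun j _ => (contDiff_coord 1 j).mul (contDiff_extJ (hA j) h))

theorem fderiv_affineLagrangian (hA : ∀ j, ContDiff ℝ (⊤ : ℕ∞) (A j))
    (hB : ContDiff ℝ (⊤ : ℕ∞) B) (h : 1 ≤ 2) (q u : Jet n 2) :
    fderiv ℝ (affineLagrangian A B h) q u =
      fderiv ℝ B (trJ 1 h q) (trJ 1 h u)
        + (∑ j, coord q 1 j * fderiv ℝ (A j) (trJ 1 h q) (trJ 1 h u)
          + ∑ j, coord u 1 j * A j (trJ 1 h q)) := by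
  have hA' (j : Fin n) : DifferentiableAt ℝ (extJ h (A j)) q :=
    ((contDiff_extJ (hA j) h).differentiable (by simp)) q
  have hB' : DifferentiableAt ℝ (extJ h B) q :=
    ((contDiff_extJ hB h).differentiable (by simp)) q
  have hS : DifferentiableAt ℝ (fun q => ∑ j, coord q 1 j * extJ h (A j) q) q :=
    (ContDiff.sum (n := 1) fun j _ => (contDiff_coord 1 j).mul
      ((contDiff_extJ (hA j) h).of_le (by simp))).differentiable one_ne_zero q
  unfold affineLagrangian
  rw [fderiv_fun_add hB' hS, add_apply, fderiv_sum_coord_mul hA',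
    fderiv_extJ hB]
  simp only [fderiv_extJ (hA _)]
  rfl

theorem pderY_one_affineLagrangian (hA : ∀ j, ContDiff ℝ (⊤ : ℕ∞) (A j))
    (hB : ContDiff ℝ (⊤ : ℕ∞) B) (h : 1 ≤ 2) (i : Fin n) :
    pderY 1 i (affineLagrangian A B h) = extJ h (A i) := by
  ext q
  have hd : trJ 1 h (dirY 1 i : Jet n 2) = 0 := by
    ext <;> simp [trJ, dirY]
  refine (fderiv_affineLagrangian hA hB h q (dirY 1 i)).trans ?_
  simp [hd, coord_dirY]
  rfl

/-- The Euler–Poisson expressions of a Lagrange function affine in the velocities. -/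
theorem eulerPoisson_affineLagrangian (hA : ∀ j, ContDiff ℝ (⊤ : ℕ∞) (A j))
    (hB : ContDiff ℝ (⊤ : ℕ∞) B) (h : 1 ≤ 2) (h' : 2 ≤ 3) (i : Fin n) (p : Jet n 3) :
    pderY 0 i (extJ h' (affineLagrangian A B h)) p
        - totD (pderY 1 i (extJ h' (affineLagrangian A B h))) p =
      (∑ j, (pderY 0 i (A j) (trJ 1 h (trJ 2 h' p)) - pderY 0 j (A i) (trJ 1 h (trJ 2 h' p)))
          * coord (trJ 2 h' p) 1 j)
        + (pderY 0 i B (trJ 1 h (trJ 2 h' p)) - pderT (A i) (trJ 1 h (trJ 2 h' p))) := by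
  rw [eulerPoisson_eq (contDiff_affineLagrangian hA hB h), pderY_one_affineLagrangian hA hB,
    pderT_extJ (hA i)]
  simp only [pderY_extJ (hA i)]
  have hd : trJ 1 h (dirY 0 i : Jet n 2) = dirY 0 i := rfl
  have h0 : pderY 0 i (affineLagrangian A B h) (trJ 2 h' p) =
      pderY 0 i B (trJ 1 h (trJ 2 h' p))
        + ∑ j, coord (trJ 2 h' p) 1 j * pderY 0 i (A j) (trJ 1 h (trJ 2 h' p)) := by
    refine (fderiv_affineLagrangian hA hB h (trJ 2 h' p) (dirY 0 i)).trans ?_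
    simp only [hd, coord_dirY (show 0 < 2 by norm_num)]
    simp [pderY, dirY]
  have e (F : Jet n 1 → ℝ) : extJ h F (trJ 2 h' p) = F (trJ 1 h (trJ 2 h' p)) := rfl
  rw [h0]
  simp only [e, pderY_of_le le_rfl, zero_mul, Finset.sum_const_zero,
    coord_trJ h' p (show 1 < 2 by norm_num), sub_mul, Finset.sum_sub_distrib, mul_comm (coord _ _ _)]
  ring

end Affine

/-- The jet with the given time and position and zero velocity. -/
def zeroVel (q : Jet n 1) : Jet n 2 := (q.1, ![q.2 0, 0])

theorem contDiff_zeroVel : ContDiff ℝ (⊤ : ℕ∞) (zeroVel (n := n)) := by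
  unfold zeroVel
  refine contDiff_fst.prodMk (contDiff_pi.2 fun r => ?_)
  fin_cases r
  · change ContDiff ℝ _ fun q : Jet n 1 => q.2 0
    fun_prop
  · exact contDiff_const

theorem coord_zeroVel (q : Jet n 1) (j : Fin n) : coord (zeroVel q) 1 j = 0 := by
  simp [coord, zeroVel]

theorem sum_smul_dirY_one (v : Fin n → ℝ) :
    ((0, ![0, v]) : Jet n 2) = ∑ j, v j • (dirY 1 j : Jet n 2) := by
  ext r i
  · simp [dirY, Prod.fst_sum]
  · fin_cases r <;> simp [dirY, Prod.snd_sum, Finset.sum_apply, Pi.single_apply]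

theorem eq_zeroVel_of_pderY_one_eq_zero {F : Jet n 2 → ℝ} (hF : ContDiff ℝ (⊤ : ℕ∞) F)
    (h0 : ∀ j q, pderY 1 j F q = 0) (h : 1 ≤ 2) (q : Jet n 2) :
    F q = F (zeroVel (trJ 1 h q)) := by
  let γ : ℝ → Jet n 2 := fun s => zeroVel (trJ 1 h q) + s • (0, ![0, q.2 1])
  have hγ (s : ℝ) : HasDerivAt γ (0, ![0, q.2 1]) s := by
    simpa only [one_smul, id] using ((hasDerivAt_id s).smul_const ((0, ![0, q.2 1]) : Jet n 2)).const_add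
      (zeroVel (trJ 1 h q))
  have hd (s : ℝ) : HasDerivAt (F ∘ γ) 0 s := by
    have := ((hF.differentiable (by simp)) (γ s)).hasFDerivAt.comp_hasDerivAt s (hγ s)
    have hz : fderiv ℝ F (γ s) (0, ![0, q.2 1]) = 0 := by
      rw [sum_smul_dirY_one, map_sum]
      refine Finset.sum_eq_zero fun j _ => ?_
      rw [map_smul]
      exact (congrArg (q.2 1 j • ·) (h0 j (γ s))).trans (smul_zero _)
    rwa [hz] at this
  have hconst := is_const_of_deriv_eq_zero (fun s => (hd s).differentiableAt)
    (fun s => (hd s).deriv) 1 0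
  have h1 : γ 1 = q := by
    ext r i
    · simp [γ, zeroVel, trJ]
    · fin_cases r <;> simp [γ, zeroVel, trJ]
  have h0' : γ 0 = zeroVel (trJ 1 h q) := by simp [γ]
  simpa [h1, h0'] using hconst

/-- A Lagrange function with vanishing velocity Hessian is affine in the velocities. -/
theorem eq_affineLagrangian {L : Jet n 2 → ℝ} (hL : ContDiff ℝ (⊤ : ℕ∞) L)
    (hH : ∀ i j q, pderY 1 j (pderY 1 i L) q = 0) (h : 1 ≤ 2) :
    L = affineLagrangian (fun j q => pderY 1 j L (zeroVel q)) (fun q => L (zeroVel q)) h := by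
  have hG (j : Fin n) := contDiff_pderY hL 1 j
  have hGd (j : Fin n) : Differentiable ℝ (pderY 1 j L) := (hG j).differentiable (by simp)
  have hS : ContDiff ℝ (⊤ : ℕ∞) fun q : Jet n 2 => ∑ j, coord q 1 j * pderY 1 j L q :=
    ContDiff.sum fun j _ => (contDiff_coord 1 j).mul (hG j)
  have hM (j : Fin n) (q : Jet n 2) :
      pderY 1 j (fun q => L q - ∑ j, coord q 1 j * pderY 1 j L q) q = 0 := by
    change fderiv ℝ (fun q => L q - ∑ j, coord q 1 j * pderY 1 j L q) q (dirY 1 j) = 0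
    rw [fderiv_fun_sub (hL.differentiable (by simp) q) (hS.differentiable (by simp) q),
      sub_apply, fderiv_sum_coord_mul fun i => hGd i q]
    have hz (i : Fin n) : fderiv ℝ (pderY 1 i L) q (dirY 1 j) = 0 := hH i j q
    simp only [hz, coord_dirY (show 1 < 2 by norm_num)]
    simp [pderY, dirY]
  ext q
  have e := eq_zeroVel_of_pderY_one_eq_zero (hL.sub hS) hM h q
  have eG (j : Fin n) := eq_zeroVel_of_pderY_one_eq_zero (hG j) (hH j) h q
  simp only [coord_zeroVel, zero_mul, Finset.sum_const_zero, sub_zero] at e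
  rw [sub_eq_iff_eq_add] at e
  rw [e]
  simp only [affineLagrangian, extJ]
  congr 1
  exact Finset.sum_congr rfl fun j _ => by rw [eG j]; rfl

/-- If the Euler–Poisson expressions do not depend on the accelerations, the velocity Hessian
vanishes. -/
theorem pderY_one_pderY_one_eq_zero {L : Jet n 2 → ℝ} (hL : ContDiff ℝ (⊤ : ℕ∞) L) (h : 2 ≤ 3)
    {e : Jet n 2 → ℝ} {i : Fin n}
    (he : ∀ p, extJ h e p = pderY 0 i (extJ h L) p - totD (pderY 1 i (extJ h L)) p)
    (j : Fin n) (q : Jet n 2) : pderY 1 j (pderY 1 i L) q = 0 := by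
  have key (w : Fin n → ℝ) := (he (q.1, ![q.2 0, q.2 1, w])).trans (eulerPoisson_eq hL h i _)
  have ht (w : Fin n → ℝ) : trJ 2 h ((q.1, ![q.2 0, q.2 1, w]) : Jet n 3) = q := by
    ext r i
    · rfl
    · fin_cases r <;> rfl
  have hx (w : Fin n → ℝ) : extJ h e ((q.1, ![q.2 0, q.2 1, w]) : Jet n 3) = e q :=
    congrArg e (ht w)
  have hc1 (w : Fin n → ℝ) (k : Fin n) :
      coord ((q.1, ![q.2 0, q.2 1, w]) : Jet n 3) 1 k = q.2 1 k := rfl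
  have hc2 (w : Fin n → ℝ) (k : Fin n) :
      coord ((q.1, ![q.2 0, q.2 1, w]) : Jet n 3) 2 k = w k := rfl
  simp only [ht, hx, hc1, hc2] at key
  have k1 := key (Pi.single j 1)
  have k0 := key 0
  simp only [Pi.single_apply, ite_mul, one_mul, zero_mul, Finset.sum_ite_eq', Finset.mem_univ,
    if_true, Pi.zero_apply, Finset.sum_const_zero] at k1 k0
  linarith

end Jets

section Poincare

variable {n : ℕ}

/-- Dilation of the position variable. -/
def dil (s : ℝ) (q : Jet n 1) : Jet n 1 := (q.1, s • q.2)

theorem contDiff_uncurry_dil {m : WithTop ℕ∞} :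
    ContDiff ℝ m fun z : ℝ × Jet n 1 => dil z.1 z.2 :=
  contDiff_snd.fst.prodMk (contDiff_fst.smul contDiff_snd.snd)

theorem contDiff_comp_dil {m : WithTop ℕ∞} {F : Jet n 1 → ℝ} (hF : ContDiff ℝ m F) (s : ℝ) :
    ContDiff ℝ m fun q => F (dil s q) :=
  hF.comp (contDiff_fst.prodMk (contDiff_snd.const_smul s))

theorem continuous_comp_dil {F : Jet n 1 → ℝ} (hF : Continuous F) (q : Jet n 1) :
    Continuous fun s => F (dil s q) :=
  hF.comp (continuous_const.prodMk (continuous_id.smul continuous_const))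

theorem fderiv_comp_dil {F : Jet n 1 → ℝ} (hF : Differentiable ℝ F) (s : ℝ) (q u : Jet n 1) :
    fderiv ℝ (fun q => F (dil s q)) q u = fderiv ℝ F (dil s q) (dil s u) := by
  have h : HasFDerivAt (fun q : Jet n 1 => dil s q)
      ((ContinuousLinearMap.fst ℝ ℝ _).prod (s • ContinuousLinearMap.snd ℝ ℝ _)) q :=
    ((ContinuousLinearMap.fst ℝ ℝ (Fin 1 → Fin n → ℝ)).prod
      (s • ContinuousLinearMap.snd ℝ ℝ (Fin 1 → Fin n → ℝ))).hasFDerivAt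
  exact congrArg (· u) ((hF (dil s q)).hasFDerivAt.comp q h).fderiv

theorem hasDerivAt_comp_dil {F : Jet n 1 → ℝ} (hF : Differentiable ℝ F) (s : ℝ) (q : Jet n 1) :
    HasDerivAt (fun s => F (dil s q)) (∑ i, coord q 0 i * pderY 0 i F (dil s q)) s := by
  have h : HasDerivAt (fun s => dil s q) (0, q.2) s := by
    have := (hasDerivAt_const s q.1).prodMk ((hasDerivAt_id s).smul_const q.2)
    rw [one_smul] at this
    exact this
  have hq : ((0, q.2) : Jet n 1) = ∑ i, coord q 0 i • (dirY 0 i : Jet n 1) := by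
    ext r i
    · simp [dirY, Prod.fst_sum]
    · fin_cases r
      simp [dirY, coord, Prod.snd_sum, Finset.sum_apply, Pi.single_apply]
  have := (hF (dil s q)).hasFDerivAt.comp_hasDerivAt s h
  rw [hq, map_sum] at this
  simp only [map_smul, smul_eq_mul] at this
  exact this

theorem continuous_sum_coord_mul_comp_dil (m : ℕ) {Φ : Fin n → Jet n 1 → ℝ}
    (hΦ : ∀ i, Continuous (Φ i)) (q : Jet n 1) :
    Continuous fun s => ∑ i, coord q 0 i * (s ^ m * Φ i (dil s q)) :=
  continuous_finsetSum _ fun i _ =>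
    continuous_const.mul ((continuous_pow m).mul (continuous_comp_dil (hΦ i) q))

/-- The radial homotopy operator `∫₀¹ Σᵢ xⁱ sᵐ Φᵢ(t, s x) ds`. -/
def radialInt (m : ℕ) (Φ : Fin n → Jet n 1 → ℝ) (q : Jet n 1) : ℝ :=
  ∫ s in (0 : ℝ)..1, ∑ i, coord q 0 i * (s ^ m * Φ i (dil s q))

variable {Φ : Fin n → Jet n 1 → ℝ}

theorem contDiff_radialInt_integrand (m : ℕ) (hΦ : ∀ i, ContDiff ℝ (⊤ : ℕ∞) (Φ i)) :
    ContDiff ℝ (⊤ : ℕ∞)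
      fun z : ℝ × Jet n 1 => ∑ i, coord z.2 0 i * (z.1 ^ m * Φ i (dil z.1 z.2)) :=
  ContDiff.sum fun i _ => ((contDiff_coord 0 i).comp contDiff_snd).mul
    ((contDiff_fst.pow m).mul ((hΦ i).comp contDiff_uncurry_dil))

theorem contDiff_radialInt (m : ℕ) (hΦ : ∀ i, ContDiff ℝ (⊤ : ℕ∞) (Φ i)) :
    ContDiff ℝ (⊤ : ℕ∞) (radialInt m Φ) :=
  contDiff_integral_section (contDiff_radialInt_integrand m hΦ)

theorem fderiv_radialInt (m : ℕ) (hΦ : ∀ i, ContDiff ℝ (⊤ : ℕ∞) (Φ i)) (q u : Jet n 1) :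
    fderiv ℝ (radialInt m Φ) q u =
      ∫ s in (0 : ℝ)..1, (∑ i, coord q 0 i * (s ^ m * fderiv ℝ (Φ i) (dil s q) (dil s u))
        + ∑ i, coord u 0 i * (s ^ m * Φ i (dil s q))) := by
  refine (fderiv_integral_section_apply
    ((contDiff_radialInt_integrand m hΦ).of_le (by simp)) q u).trans ?_
  refine intervalIntegral.integral_congr fun s _ => ?_
  have hd (i : Fin n) : DifferentiableAt ℝ (fun q => Φ i (dil s q)) q :=
    (contDiff_comp_dil (hΦ i) s).differentiable (by simp) q
  refine (fderiv_sum_coord_mul (F := fun i q => s ^ m * Φ i (dil s q))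
    (fun i => (hd i).const_mul _) 0 u).trans ?_
  simp only [fderiv_const_mul (hd _), smul_apply, smul_eq_mul,
    fderiv_comp_dil ((hΦ _).differentiable (by simp))]

theorem pderT_radialInt (m : ℕ) (hΦ : ∀ i, ContDiff ℝ (⊤ : ℕ∞) (Φ i)) (q : Jet n 1) :
    pderT (radialInt m Φ) q =
      ∫ s in (0 : ℝ)..1, ∑ i, coord q 0 i * (s ^ m * pderT (Φ i) (dil s q)) := by
  refine (fderiv_radialInt m hΦ q (1, 0)).trans ?_
  simp [coord_dirT, dil, pderT]

theorem pderY_radialInt (m : ℕ) (hΦ : ∀ i, ContDiff ℝ (⊤ : ℕ∞) (Φ i)) (k : Fin n)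
    (q : Jet n 1) :
    pderY 0 k (radialInt m Φ) q =
      ∫ s in (0 : ℝ)..1, (∑ i, coord q 0 i * (s ^ (m + 1) * pderY 0 k (Φ i) (dil s q))
        + s ^ m * Φ k (dil s q)) := by
  refine (fderiv_radialInt m hΦ q (dirY 0 k)).trans ?_
  have hd (s : ℝ) : dil s (dirY 0 k : Jet n 1) = s • dirY 0 k := by simp [dil, dirY]
  simp only [hd, map_smul, smul_eq_mul, coord_dirY one_pos]
  simp [pow_succ, mul_assoc, pderY, dirY]

theorem integral_radial_deriv (m : ℕ) {F : Jet n 1 → ℝ} (hF : ContDiff ℝ (⊤ : ℕ∞) F)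
    (q : Jet n 1) :
    ∫ s in (0 : ℝ)..1, (∑ i, coord q 0 i * (s ^ (m + 1) * pderY 0 i F (dil s q))
      + (m + 1) * s ^ m * F (dil s q)) = F q := by
  have hd (s : ℝ) : HasDerivAt (fun s => s ^ (m + 1) * F (dil s q))
      (∑ i, coord q 0 i * (s ^ (m + 1) * pderY 0 i F (dil s q))
        + (m + 1) * s ^ m * F (dil s q)) s := by
    refine ((hasDerivAt_pow (m + 1) s).fun_mul
      (hasDerivAt_comp_dil (hF.differentiable (by simp)) s q)).congr_deriv ?_
    rw [Finset.mul_sum, add_comm]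
    push_cast
    congr 1
    exact Finset.sum_congr rfl fun i _ => by ring
  have hc := (continuous_sum_coord_mul_comp_dil (m + 1)
    (fun i => (contDiff_pderY hF 0 i).continuous) q).add
      (((continuous_const (y := (m : ℝ) + 1)).mul (continuous_pow m)).mul (continuous_comp_dil hF.continuous q))
  rw [intervalIntegral.integral_eq_sub_of_hasDerivAt (fun s _ => hd s)
    (hc.intervalIntegrable _ _)]
  simp [dil]

theorem pderY_radialInt_sub (Ψ : Fin n → Fin n → Jet n 1 → ℝ)
    (hΨ : ∀ i j, ContDiff ℝ (⊤ : ℕ∞) (Ψ i j)) (hskew : ∀ i j q, Ψ i j q = - Ψ j i q)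
    (hcl : ∀ (i j k : Fin n) (q : Jet n 1),
      pderY 0 i (Ψ j k) q + pderY 0 j (Ψ k i) q + pderY 0 k (Ψ i j) q = 0)
    (k j : Fin n) (q : Jet n 1) :
    pderY 0 k (radialInt 1 fun i => Ψ i j) q - pderY 0 j (radialInt 1 fun i => Ψ i k) q
      = Ψ k j q := by
  have hneg (i j l : Fin n) (q : Jet n 1) : pderY 0 l (Ψ i j) q = - pderY 0 l (Ψ j i) q := by
    have : Ψ i j = fun q => - Ψ j i q := funext (hskew i j)
    simp only [pderY]
    rw [this, fderiv_fun_neg]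
    rfl
  rw [pderY_radialInt 1 fun i => hΨ i j, pderY_radialInt 1 fun i => hΨ i k,
    ← intervalIntegral.integral_sub, ← integral_radial_deriv 1 (hΨ k j) q]
  · refine intervalIntegral.integral_congr fun s _ => ?_
    rw [add_sub_add_comm, ← Finset.sum_sub_distrib]
    congr 1
    · refine Finset.sum_congr rfl fun i _ => ?_
      have h1 := hcl k i j (dil s q)
      rw [hneg j k i, hneg k i j] at h1
      linear_combination (coord q 0 i * s ^ 2) * h1
    · rw [hskew j k]
      push_cast
      ring
  all_goals
    exact ((continuous_sum_coord_mul_comp_dil _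
      (fun i => (contDiff_pderY (hΨ i _) 0 _).continuous) q).add
        ((continuous_pow _).mul
          (continuous_comp_dil (hΨ _ _).continuous q))).intervalIntegrable _ _

theorem pderY_radialInt_sub_pderT_radialInt (Ψ : Fin n → Fin n → Jet n 1 → ℝ)
    (ψ : Fin n → Jet n 1 → ℝ) (hΨ : ∀ i j, ContDiff ℝ (⊤ : ℕ∞) (Ψ i j))
    (hψ : ∀ i, ContDiff ℝ (⊤ : ℕ∞) (ψ i)) (hskew : ∀ i j q, Ψ i j q = - Ψ j i q)
    (hcl : ∀ (i j : Fin n) (q : Jet n 1),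
      pderY 0 i (ψ j) q - pderY 0 j (ψ i) q + pderT (Ψ i j) q = 0)
    (k : Fin n) (q : Jet n 1) :
    pderY 0 k (radialInt 0 ψ) q - pderT (radialInt 1 fun i => Ψ i k) q = ψ k q := by
  have hneg (i j : Fin n) (q : Jet n 1) : pderT (Ψ i j) q = - pderT (Ψ j i) q := by
    have : Ψ i j = fun q => - Ψ j i q := funext (hskew i j)
    simp only [pderT]
    rw [this, fderiv_fun_neg]
    rfl
  rw [pderY_radialInt 0 hψ, pderT_radialInt 1 fun i => hΨ i k,
    ← intervalIntegral.integral_sub, ← integral_radial_deriv 0 (hψ k) q]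
  · refine intervalIntegral.integral_congr fun s _ => ?_
    rw [add_sub_right_comm, ← Finset.sum_sub_distrib]
    congr 1
    · refine Finset.sum_congr rfl fun i _ => ?_
      have h1 := hcl k i (dil s q)
      rw [hneg k i] at h1
      linear_combination (coord q 0 i * s) * h1
    · push_cast
      ring
  · exact ((continuous_sum_coord_mul_comp_dil _
      (fun i => (contDiff_pderY (hψ i) 0 k).continuous) q).add
        ((continuous_pow _).mul
          (continuous_comp_dil (hψ k).continuous q))).intervalIntegrable _ _
  · exact (continuous_sum_coord_mul_comp_dil _
      (fun i => (contDiff_pderT (hΨ i k)).continuous) q).intervalIntegrable _ _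

end Poincare

/-- first-order variational ODEs / self-adjointness.
A system of smooth first-order expressions `E_i(t,x,v)` consists of the Euler–Poisson
expressions `∂L/∂x^i − D_t(∂L/∂v^i)` of some smooth first-order Lagrange function
`L(t,x,v)` (both regarded as functions of `(t,x,v,w)`) if and only if
`E_i = Ψ_{ij}v^j + ψ_i` with `Ψ` skew-symmetric, `Ψ, ψ` functions of `(t,x)` only, and
`∂Ψ_{jk}/∂x^i + ∂Ψ_{ki}/∂x^j + ∂Ψ_{ij}/∂x^k = 0`,
`∂ψ_j/∂x^i − ∂ψ_i/∂x^j + ∂Ψ_{ij}/∂t = 0` identically. -/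
theorem statement_6 (n : ℕ) (hn : 1 ≤ n)
    (E : Fin n → Jet n 2 → ℝ) (hE : ∀ i, ContDiff ℝ (⊤ : ℕ∞) (E i)) :
    (∃ L : Jet n 2 → ℝ, ContDiff ℝ (⊤ : ℕ∞) L ∧
        ∀ (i : Fin n) (p : Jet n 3),
          extJ (M := 3) (by omega) (E i) p =
            pderY 0 i (extJ (M := 3) (by omega) L) p
              - totD (pderY 1 i (extJ (M := 3) (by omega) L)) p) ↔
    (∃ (Ψ : Fin n → Fin n → Jet n 1 → ℝ) (ψ : Fin n → Jet n 1 → ℝ),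
      (∀ i j, ContDiff ℝ (⊤ : ℕ∞) (Ψ i j)) ∧
      (∀ i, ContDiff ℝ (⊤ : ℕ∞) (ψ i)) ∧
      (∀ i j q, Ψ i j q = - Ψ j i q) ∧
      (∀ (i : Fin n) (p : Jet n 2),
        E i p = (∑ j, Ψ i j (trJ 1 (by omega) p) * coord p 1 j) + ψ i (trJ 1 (by omega) p)) ∧
      (∀ (i j k : Fin n) (q : Jet n 1),
        pderY 0 i (Ψ j k) q + pderY 0 j (Ψ k i) q + pderY 0 k (Ψ i j) q = 0) ∧
      (∀ (i j : Fin n) (q : Jet n 1),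
        pderY 0 i (ψ j) q - pderY 0 j (ψ i) q + pderT (Ψ i j) q = 0)) := by
  have h12 : 1 ≤ 2 := one_le_two
  have h23 : 2 ≤ 3 := by norm_num
  constructor
  · rintro ⟨L, hL, hE'⟩
    have hH (i j : Fin n) (q : Jet n 2) := pderY_one_pderY_one_eq_zero hL h23 (hE' i) j q
    set A : Fin n → Jet n 1 → ℝ := fun j q => pderY 1 j L (zeroVel q)
    set B : Jet n 1 → ℝ := fun q => L (zeroVel q)
    have hA (j : Fin n) : ContDiff ℝ (⊤ : ℕ∞) (A j) :=
      (contDiff_pderY hL 1 j).comp contDiff_zeroVel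
    have hB : ContDiff ℝ (⊤ : ℕ∞) B := hL.comp contDiff_zeroVel
    have hLA : L = affineLagrangian A B h12 := eq_affineLagrangian hL hH h12
    have hdY (F : Jet n 1 → ℝ) (hF : ContDiff ℝ (⊤ : ℕ∞) F) (i : Fin n) :
      Differentiable ℝ (pderY 0 i F) := (contDiff_pderY hF 0 i).differentiable (by simp)
    have hdT (F : Jet n 1 → ℝ) (hF : ContDiff ℝ (⊤ : ℕ∞) F) :
      Differentiable ℝ (pderT F) := (contDiff_pderT hF).differentiable (by simp)
    have hYY (F : Jet n 1 → ℝ) (hF : ContDiff ℝ (⊤ : ℕ∞) F) (i j : Fin n) (q : Jet n 1) :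
        pderY 0 i (pderY 0 j F) q = pderY 0 j (pderY 0 i F) q :=
      fderiv_fderiv_apply_comm hF q _ _
    have hYT (F : Jet n 1 → ℝ) (hF : ContDiff ℝ (⊤ : ℕ∞) F) (i : Fin n) (q : Jet n 1) :
        pderY 0 i (pderT F) q = pderT (pderY 0 i F) q :=
      fderiv_fderiv_apply_comm hF q _ _
    have hYsub (F G : Jet n 1 → ℝ) (hF : Differentiable ℝ F) (hG : Differentiable ℝ G)
        (i : Fin n) (q : Jet n 1) :
        pderY 0 i (fun q => F q - G q) q = pderY 0 i F q - pderY 0 i G q := by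
      simp only [pderY, fderiv_fun_sub (hF q) (hG q), sub_apply]
    have hTsub (F G : Jet n 1 → ℝ) (hF : Differentiable ℝ F) (hG : Differentiable ℝ G)
        (q : Jet n 1) : pderT (fun q => F q - G q) q = pderT F q - pderT G q := by
      simp only [pderT, fderiv_fun_sub (hF q) (hG q), sub_apply]
    refine ⟨fun i j q => pderY 0 i (A j) q - pderY 0 j (A i) q,
      fun i q => pderY 0 i B q - pderT (A i) q,
      fun i j => (contDiff_pderY (hA j) 0 i).sub (contDiff_pderY (hA i) 0 j),
      fun i => (contDiff_pderY hB 0 i).sub (contDiff_pderT (hA i)),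
      fun i j q => by ring, fun i p => ?_, fun i j k q => ?_, fun i j q => ?_⟩
    · have ht : trJ 2 h23 ((p.1, ![p.2 0, p.2 1, 0]) : Jet n 3) = p := by
        ext r i
        · rfl
        · fin_cases r <;> rfl
      have key := hE' i (p.1, ![p.2 0, p.2 1, 0])
      rw [hLA, eulerPoisson_affineLagrangian hA hB h12 h23, ht] at key
      exact (congrArg (E i) ht).symm.trans key
    · rw [hYsub _ _ (hdY _ (hA k) j) (hdY _ (hA j) k),
        hYsub _ _ (hdY _ (hA i) k) (hdY _ (hA k) i), hYsub _ _ (hdY _ (hA j) i) (hdY _ (hA i) j),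
        hYY _ (hA k) i j, hYY _ (hA j) i k, hYY _ (hA i) j k]
      ring
    · rw [hYsub _ _ (hdY _ hB j) (hdT _ (hA j)), hYsub _ _ (hdY _ hB i) (hdT _ (hA i)),
        hTsub _ _ (hdY _ (hA j) i) (hdY _ (hA i) j), hYY _ hB i j, hYT _ (hA j), hYT _ (hA i)]
      ring
  · rintro ⟨Ψ, ψ, hΨ, hψ, hskew, hEΨ, hcl, hcl'⟩
    have hA (j : Fin n) : ContDiff ℝ (⊤ : ℕ∞) (radialInt 1 fun i => Ψ i j) :=
      contDiff_radialInt 1 fun i => hΨ i j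
    have hB := contDiff_radialInt 0 hψ
    refine ⟨affineLagrangian (fun j => radialInt 1 fun i => Ψ i j) (radialInt 0 ψ) h12,
      contDiff_affineLagrangian hA hB h12, fun i p => ?_⟩
    rw [eulerPoisson_affineLagrangian hA hB h12 h23]
    simp only [pderY_radialInt_sub Ψ hΨ hskew hcl,
      pderY_radialInt_sub_pderT_radialInt Ψ ψ hΨ hψ hskew hcl']
    exact hEΨ i (trJ 2 h23 p)
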